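/- arXiv:2004.08032 — 8 statements merged into one kernel-verified Lean document; each statement's English description precedes it below -/
import Mathlib

section
/- Let 0 < r ≤ 1 and z ∈ ℝ. Then the function θ ↦ ℓ(θ | r, z) has a unique global minimizer θ̂ over ℝ, given by θ̂ = θ*(z, r) if |z| ≥ r and θ̂ = 0 if |z| < r. -/
/-- The LAAD univariate objective `ℓ(θ | r, z) = (1/2)(z − θ)² + r·log(1 + |θ|)`. -/
noncomputable def laadLoss (r z θ : ℝ) : ℝ :=
  (1 / 2) * (z - θ) ^ 2 + r * Real.log (1 + |θ|)

/-- `θ*(z, r) = (1/2)[z + sgn(z)(√((|z| − 1)² + 4|z| − 4r) − 1)]`. -/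
noncomputable def thetaStar (z r : ℝ) : ℝ :=
  (1 / 2) * (z + Real.sign z * (Real.sqrt ((|z| - 1) ^ 2 + 4 * |z| - 4 * r) - 1))

theorem sub_sq_div_two_lt_log_one_add {x : ℝ} (hx : 0 < x) :
    x - x ^ 2 / 2 < Real.log (1 + x) := by
  refine lt_of_lt_of_le ?_ (Real.le_log_one_add_of_nonneg hx.le)
  rw [lt_div_iff₀ (by linarith)]
  nlinarith [pow_pos hx 3]

theorem sub_inv_div_two_le_log {x : ℝ} (hx0 : 0 < x) (hx1 : x ≤ 1) :
    (x - x⁻¹) / 2 ≤ Real.log x := by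
  rw [← Real.sinh_log hx0]
  exact Real.sinh_le_self_iff.2 (Real.log_nonpos hx0.le hx1)

theorem laadLoss_neg_neg (r z θ : ℝ) : laadLoss r (-z) (-θ) = laadLoss r z θ := by
  simp only [laadLoss, abs_neg]
  ring

theorem thetaStar_neg (z r : ℝ) : thetaStar (-z) r = -thetaStar z r := by
  simp only [thetaStar, abs_neg, Real.sign_neg]
  ring

theorem thetaStar_nonneg {r z : ℝ} (hz : 0 < z) (hrz : r ≤ z) : 0 ≤ thetaStar z r := by
  have h : |1 - z| ≤ √((z - 1) ^ 2 + 4 * z - 4 * r) := Real.abs_le_sqrt (by nlinarith)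
  rw [thetaStar, Real.sign_of_pos hz, abs_of_pos hz]
  linarith [le_abs_self (1 - z)]

theorem thetaStar_stationary {r z : ℝ} (hz : 0 < z) (hrz : r ≤ z) :
    (z - thetaStar z r) * (1 + thetaStar z r) = r := by
  have h := Real.sq_sqrt (show 0 ≤ (z - 1) ^ 2 + 4 * z - 4 * r by nlinarith [sq_nonneg (z - 1)])
  rw [thetaStar, Real.sign_of_pos hz, abs_of_pos hz]
  linear_combination -h / 4

/-- A first-order critical point of `laadLoss r z` on `[0, ∞)` is its strict minimizer there. -/
theorem laadLoss_lt_of_nonneg {r z a t : ℝ} (hr0 : 0 < r) (hr1 : r ≤ 1) (ha : 0 ≤ a)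
    (hle : (z - a) * (1 + a) ≤ r) (heq : 0 < a → (z - a) * (1 + a) = r) (ht : 0 ≤ t)
    (hta : t ≠ a) : laadLoss r z a < laadLoss r z t := by
  have ha1 : 0 < 1 + a := by linarith
  obtain ⟨h, rfl⟩ : ∃ h, t = a + (1 + a) * h := ⟨(t - a) / (1 + a), by field_simp; ring⟩
  have hh : h ≠ 0 := by rintro rfl; simp at hta
  have hpos : 0 < 1 + h := by nlinarith
  have hlog : Real.log (1 + (a + (1 + a) * h)) = Real.log (1 + a) + Real.log (1 + h) := by
    rw [← Real.log_mul ha1.ne' hpos.ne']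
    ring_nf
  simp only [laadLoss, abs_of_nonneg ha, abs_of_nonneg ht, hlog]
  have hsq : 0 < h ^ 2 := by positivity
  suffices 0 < (1 + a) ^ 2 * h ^ 2 / 2 - (z - a) * (1 + a) * h + r * Real.log (1 + h) by
    linarith
  rcases lt_or_gt_of_ne hh with hneg | hgt
  · have ha0 : 0 < a := ha.lt_of_ne (by rintro rfl; linarith)
    rw [heq ha0]
    have hbound := sub_inv_div_two_le_log hpos (by linarith)
    have hinv : (1 + h)⁻¹ ≤ 1 + a := by
      rw [inv_le_iff_one_le_mul₀ hpos]
      linarith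
    have hid : (1 + h - (1 + h)⁻¹) / 2 = h - h ^ 2 * (1 + h)⁻¹ / 2 := by
      field_simp
      ring
    have h1 : h - h ^ 2 * (1 + a) / 2 ≤ Real.log (1 + h) := by
      linarith [mul_le_mul_of_nonneg_left hinv hsq.le]
    have h2 := mul_le_mul_of_nonneg_left h1 hr0.le
    have h3 : 0 < h ^ 2 * (1 + a) * (1 + a - r) := mul_pos (by positivity) (by linarith)
    linarith
  · have h1 := mul_lt_mul_of_pos_left (sub_sq_div_two_lt_log_one_add hgt) hr0
    have h2 := mul_le_mul_of_nonneg_right hle hgt.le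
    have h3 : 0 ≤ h ^ 2 * ((1 + a) ^ 2 - r) := mul_nonneg hsq.le (by nlinarith)
    linarith

/-- For `z ≥ 0`, a nonnegative first-order critical point is the strict global minimizer. -/
theorem laadLoss_lt_of_stationary {r z a θ : ℝ} (hr0 : 0 < r) (hr1 : r ≤ 1) (hz : 0 ≤ z)
    (ha : 0 ≤ a) (hle : (z - a) * (1 + a) ≤ r) (heq : 0 < a → (z - a) * (1 + a) = r)
    (hθ : θ ≠ a) : laadLoss r z a < laadLoss r z θ := by
  rcases le_or_gt 0 θ with h | h
  · exact laadLoss_lt_of_nonneg hr0 hr1 ha hle heq h hθ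
  have hsub : laadLoss r z θ - laadLoss r z (-θ) = 2 * z * -θ := by
    simp only [laadLoss, abs_neg]
    ring
  by_cases hc : -θ = a
  · have ha0 : 0 < a := by linarith
    have hz0 : 0 < z := by nlinarith [heq ha0]
    have : 0 < 2 * z * -θ := mul_pos (by linarith) (by linarith)
    rw [← hc]
    linarith
  · have h1 := laadLoss_lt_of_nonneg hr0 hr1 ha hle heq (neg_pos.2 h).le hc
    have : 0 ≤ 2 * z * -θ := mul_nonneg (by linarith) (by linarith)
    linarith

theorem laadLoss_lt_of_zero_le {r z θ : ℝ} (hr0 : 0 < r) (hr1 : r ≤ 1) (hz : 0 ≤ z)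
    (hθ : θ ≠ if r ≤ |z| then thetaStar z r else 0) :
    laadLoss r z (if r ≤ |z| then thetaStar z r else 0) < laadLoss r z θ := by
  rw [abs_of_nonneg hz] at hθ ⊢
  split_ifs at hθ ⊢ with h
  · have hs := thetaStar_stationary (hr0.trans_le h) h
    exact laadLoss_lt_of_stationary hr0 hr1 hz (thetaStar_nonneg (hr0.trans_le h) h) hs.le
      (fun _ => hs) hθ
  · exact laadLoss_lt_of_stationary hr0 hr1 hz le_rfl (by linarith)
      (fun h0 => absurd h0 (lt_irrefl 0)) hθ

/-- For `0 < r ≤ 1` and `z ∈ ℝ`, the function `θ ↦ ℓ(θ | r, z)` has a unique global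
minimizer over ℝ, namely `θ*(z, r)` if `|z| ≥ r` and `0` if `|z| < r`. -/
theorem stmt_0 (r z : ℝ) (hr0 : 0 < r) (hr1 : r ≤ 1) :
    ∀ θ : ℝ, θ ≠ (if r ≤ |z| then thetaStar z r else 0) →
      laadLoss r z (if r ≤ |z| then thetaStar z r else 0) < laadLoss r z θ := by
  intro θ hθ
  rcases le_total 0 z with hz | hz
  · exact laadLoss_lt_of_zero_le hr0 hr1 hz hθ
  have hite : (if r ≤ |-z| then thetaStar (-z) r else 0) =
      -(if r ≤ |z| then thetaStar z r else 0) := by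
    rw [abs_neg, thetaStar_neg]
    split_ifs <;> simp
  have h := laadLoss_lt_of_zero_le (θ := -θ) hr0 hr1 (neg_nonneg.2 hz)
    (by rw [hite]; exact neg_injective.ne hθ)
  rwa [hite, laadLoss_neg_neg, laadLoss_neg_neg] at h
end

section
/- Let r > 0 and let z satisfy 0 ≤ z, z < r and z < 1. Then the function θ ↦ ℓ(θ | r, z) is strictly increasing on [0, ∞), and 0 is its unique global minimizer over ℝ. -/
theorem hasDerivAt_half_sq_add_log (r z x : ℝ) (hx : 0 < 1 + x) :
    HasDerivAt (fun θ : ℝ => (1 / 2) * (z - θ) ^ 2 + r * Real.log (1 + θ))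
      (x - z + r / (1 + x)) x := by
  have h₁ := (((hasDerivAt_id x).const_sub z).pow 2).const_mul (1 / 2 : ℝ)
  have h₂ := (((hasDerivAt_id x).const_add 1).log hx.ne').const_mul r
  refine (h₁.add h₂).congr_deriv ?_
  simp only [id]
  norm_num
  ring

theorem laadLoss_strictMonoOn (r z : ℝ) (hzr : z < r) (hz1 : z < 1) :
    StrictMonoOn (fun θ => laadLoss r z θ) (Set.Ici (0 : ℝ)) := by
  have h : StrictMonoOn (fun θ : ℝ => (1 / 2) * (z - θ) ^ 2 + r * Real.log (1 + θ))
      (Set.Ici (0 : ℝ)) := by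
    refine strictMonoOn_of_deriv_pos (convex_Ici 0) (fun x hx => ?_) (fun x hx => ?_)
    · have hx0 : 0 ≤ x := hx
      exact (hasDerivAt_half_sq_add_log r z x (by linarith)).continuousAt.continuousWithinAt
    · rw [interior_Ici] at hx
      have hx0 : 0 < x := hx
      have hx1 : 0 < 1 + x := by linarith
      rw [(hasDerivAt_half_sq_add_log r z x hx1).deriv]
      have key : x - z + r / (1 + x) = (x ^ 2 + (1 - z) * x + (r - z)) / (1 + x) := by
        field_simp
        ring
      rw [key]
      have : 0 < 1 - z := by linarith
      have : 0 < r - z := by linarith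
      positivity
  refine h.congr fun x hx => ?_
  simp only [laadLoss, abs_of_nonneg (Set.mem_Ici.mp hx)]

theorem laadLoss_abs_le (r z θ : ℝ) (hz0 : 0 ≤ z) : laadLoss r z |θ| ≤ laadLoss r z θ := by
  have h : z * θ ≤ z * |θ| := mul_le_mul_of_nonneg_left (le_abs_self θ) hz0
  simp only [laadLoss, abs_abs]
  nlinarith [sq_abs θ]

/-- For `r > 0` and `0 ≤ z` with `z < r` and `z < 1`, the function `θ ↦ ℓ(θ | r, z)`
is strictly increasing on `[0, ∞)` and `0` is its unique global minimizer over ℝ. -/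
theorem stmt_3 (r z : ℝ) (hr : 0 < r) (hz0 : 0 ≤ z) (hzr : z < r) (hz1 : z < 1) :
    StrictMonoOn (fun θ => laadLoss r z θ) (Set.Ici (0 : ℝ)) ∧
    ∀ θ : ℝ, θ ≠ 0 → laadLoss r z 0 < laadLoss r z θ := by
  have hmono := laadLoss_strictMonoOn r z hzr hz1
  refine ⟨hmono, fun θ hθ => ?_⟩
  exact (hmono Set.self_mem_Ici (abs_nonneg θ) (abs_pos.mpr hθ)).trans_le
    (laadLoss_abs_le r z θ hz0)
end

section
/- Let z ≥ 0 and let r ≥ ((z + 1)/2)². Then 0 is the unique global minimizer over ℝ of the function θ ↦ ℓ(θ | r, z). -/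
/-- For `z ≥ 0` and `r ≥ ((z + 1)/2)²`, `0` is the unique global minimizer over ℝ of
`θ ↦ ℓ(θ | r, z)`. -/
theorem stmt_4 (r z : ℝ) (hz : 0 ≤ z) (hr : ((z + 1) / 2) ^ 2 ≤ r) :
    ∀ θ : ℝ, θ ≠ 0 → laadLoss r z 0 < laadLoss r z θ := by
  intro θ hθ
  have ht : 0 < |θ| := abs_pos.mpr hθ
  have hzθ : z * θ ≤ z * |θ| := mul_le_mul_of_nonneg_left (le_abs_self θ) hz
  have hsq : |θ| ^ 2 = θ ^ 2 := sq_abs θ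
  simp only [laadLoss, abs_zero, add_zero, Real.log_one, mul_zero, sub_zero]
  generalize |θ| = t at *
  have hlog : 2 * t / (t + 2) < Real.log (1 + t) := Real.lt_log_one_add_of_pos ht
  have hpos : 0 < 2 * t / (t + 2) := by positivity
  have hmul : ((z + 1) / 2) ^ 2 * (2 * t / (t + 2)) < r * Real.log (1 + t) :=
    calc ((z + 1) / 2) ^ 2 * (2 * t / (t + 2))
        < ((z + 1) / 2) ^ 2 * Real.log (1 + t) := by gcongr
      _ ≤ r * Real.log (1 + t) := mul_le_mul_of_nonneg_right hr (hpos.trans hlog).le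
  have hcomplete : ((z + 1) / 2) ^ 2 * (2 * t / (t + 2)) + t ^ 2 / 2 - z * t
      = 2 * t / (t + 2) * ((z + 1) / 2 - (t + 2) / 2) ^ 2 := by
    field_simp
    ring
  have hnonneg : 0 ≤ 2 * t / (t + 2) * ((z + 1) / 2 - (t + 2) / 2) ^ 2 := by positivity
  linarith [show (z - θ) ^ 2 = z ^ 2 - 2 * (z * θ) + θ ^ 2 by ring]
end

section
/- For any r > 0 and z ∈ ℝ, every global minimizer θ̂ over ℝ of the function θ ↦ ℓ(θ | r, z) satisfies θ̂·z ≥ 0. -/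
/-- For any `r > 0` and `z ∈ ℝ`, every global minimizer `θ̂` of `θ ↦ ℓ(θ | r, z)` over ℝ
satisfies `θ̂ · z ≥ 0`. -/
theorem stmt_5 (r z : ℝ) (hr : 0 < r) (θhat : ℝ)
    (hmin : ∀ θ : ℝ, laadLoss r z θhat ≤ laadLoss r z θ) :
    θhat * z ≥ 0 := by
  have h := hmin (-θhat)
  simp only [laadLoss, abs_neg] at h
  linarith
end

section
/- Suppose ‖X_j‖ = 1 for all j = 1, …, p and 0 < r ≤ 1. Then for each j and each fixed values of the coordinates β_i (i ≠ j), the coordinate section ℓ_j : β_j ↦ ℓ(β₁, …, β_p) is both quasi-convex and hemivariate on ℝ. -/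
/-- The LAAD-penalized least-squares objective
`ℓ(β) = (1/2)‖y − Xβ‖² + r·Σⱼ log(1 + |βⱼ|)`, where `X` has columns `X₁, …, X_p`. -/
noncomputable def laadObj {n p : ℕ} (y : EuclideanSpace ℝ (Fin n))
    (X : Fin p → EuclideanSpace ℝ (Fin n)) (r : ℝ) (β : Fin p → ℝ) : ℝ :=
  (1 / 2) * ‖y - ∑ j, β j • X j‖ ^ 2 + r * ∑ j, Real.log (1 + |β j|)

/-- `f : ℝ → ℝ` is quasi-convex if `f(x + λd) ≤ max {f(x), f(x + d)}` for all `x, d`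
and `λ ∈ [0, 1]`. -/
def QuasiConvexFn (f : ℝ → ℝ) : Prop :=
  ∀ x d : ℝ, ∀ l ∈ Set.Icc (0 : ℝ) 1, f (x + l * d) ≤ max (f x) (f (x + d))

/-- `f : ℝ → ℝ` is hemivariate if it is not constant on any nondegenerate interval. -/
def Hemivariate (f : ℝ → ℝ) : Prop :=
  ∀ a b : ℝ, a < b → ¬ ∃ c : ℝ, ∀ x ∈ Set.Icc a b, f x = c

/-- The scalar profile `t²/2 + r log(1 + t)` is strictly convex on `[0, ∞)` when `r ≤ 1`. -/
lemma strictConvexOn_half_sq_add_log {r : ℝ} (hr1 : r ≤ 1) :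
    StrictConvexOn ℝ (Set.Ici 0) (fun t : ℝ => t ^ 2 / 2 + r * Real.log (1 + t)) := by
  have hd : ∀ t : ℝ, 0 ≤ t →
      HasDerivAt (fun t : ℝ => t ^ 2 / 2 + r * Real.log (1 + t)) (t + r / (1 + t)) t := by
    intro t ht
    have h1 : HasDerivAt (fun t : ℝ => 1 + t) 1 t := (hasDerivAt_id t).const_add 1
    have h2 := ((hasDerivAt_pow 2 t).div_const 2).add
      ((h1.log (by positivity)).const_mul r)
    refine h2.congr_deriv ?_
    push_cast
    ring
  refine StrictMonoOn.strictConvexOn_of_deriv (convex_Ici 0)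
    (fun t ht => (hd t ht).continuousAt.continuousWithinAt) ?_
  rw [interior_Ici]
  intro s hs t ht hst
  have hs : 0 < s := hs
  have ht : 0 < t := ht
  rw [(hd s hs.le).deriv, (hd t ht.le).deriv]
  have key : t + r / (1 + t) - (s + r / (1 + s))
      = (t - s) * ((1 + s) * (1 + t) - r) / ((1 + s) * (1 + t)) := by
    field_simp
    ring
  have : 0 < (t - s) * ((1 + s) * (1 + t) - r) / ((1 + s) * (1 + t)) :=
    div_pos (mul_pos (by linarith) (by nlinarith)) (by positivity)
  linarith

lemma strictMonoOn_half_sq_add_log {r : ℝ} (hr0 : 0 < r) :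
    StrictMonoOn (fun t : ℝ => t ^ 2 / 2 + r * Real.log (1 + t)) (Set.Ici 0) := by
  intro s hs t _ hst
  have hs : 0 ≤ s := hs
  have h1 : Real.log (1 + s) ≤ Real.log (1 + t) :=
    Real.log_le_log (by linarith) (by linarith)
  have h2 := mul_le_mul_of_nonneg_left h1 hr0.le
  show s ^ 2 / 2 + r * Real.log (1 + s) < t ^ 2 / 2 + r * Real.log (1 + t)
  nlinarith

/-- A strictly convex, strictly increasing function of `|x|` is strictly convex. -/
lemma StrictConvexOn.comp_abs {h : ℝ → ℝ} (hc : StrictConvexOn ℝ (Set.Ici 0) h)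
    (hm : StrictMonoOn h (Set.Ici 0)) : StrictConvexOn ℝ Set.univ (fun x => h |x|) := by
  refine ⟨convex_univ, fun x _ y _ hxy a b ha hb hab => ?_⟩
  simp only [smul_eq_mul]
  have htri : |a * x + b * y| ≤ a * |x| + b * |y| := by
    simpa [abs_mul, abs_of_pos ha, abs_of_pos hb] using abs_add_le (a * x) (b * y)
  have hnn : 0 ≤ a * |x| + b * |y| := by positivity
  by_cases he : |x| = |y|
  · have hyx : y = -x := by
      rcases abs_eq_abs.1 he with h | h
      · exact absurd h hxy
      · linarith
    have hx : x ≠ 0 := by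
      rintro rfl
      exact hxy (by simp [hyx])
    have hlt : |a * x + b * y| < |x| := by
      have : a * x + b * y = (a - b) * x := by rw [hyx]; ring
      rw [this, abs_mul]
      have : |a - b| < 1 := abs_lt.2 ⟨by linarith, by linarith⟩
      have := abs_pos.2 hx
      nlinarith
    calc h |a * x + b * y| < h |x| := hm (Set.mem_Ici.2 (abs_nonneg _)) (Set.mem_Ici.2 (abs_nonneg _)) hlt
      _ = a * h |x| + b * h |y| := by rw [← he, ← add_mul, hab, one_mul]
  · calc h |a * x + b * y| ≤ h (a * |x| + b * |y|) :=
          hm.monotoneOn (Set.mem_Ici.2 (abs_nonneg _)) hnn htri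
      _ < a * h |x| + b * h |y| := by
          simpa using hc.2 (Set.mem_Ici.2 (abs_nonneg x)) (Set.mem_Ici.2 (abs_nonneg y)) he ha hb hab

/-- Each coordinate section of the objective is the even profile plus an affine function. -/
lemma laadObj_update_eq {n p : ℕ} (y : EuclideanSpace ℝ (Fin n))
    (X : Fin p → EuclideanSpace ℝ (Fin n)) (r : ℝ) (j : Fin p) (hX : ‖X j‖ = 1)
    (w : Fin p → ℝ) : ∃ b c : ℝ, ∀ θ : ℝ,
      laadObj y X r (Function.update w j θ)
        = (|θ| ^ 2 / 2 + r * Real.log (1 + |θ|)) + (b * θ + c) := by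
  set u := y - ∑ i ∈ Finset.univ.erase j, w i • X i with hu
  refine ⟨-inner ℝ u (X j),
    ‖u‖ ^ 2 / 2 + r * ∑ i ∈ Finset.univ.erase j, Real.log (1 + |w i|), fun θ => ?_⟩
  have h1 : y - ∑ i, Function.update w j θ i • X i = u - θ • X j := by
    rw [← Finset.add_sum_erase _ _ (Finset.mem_univ j), Function.update_self,
      Finset.sum_congr rfl (fun i hi => by
        rw [Function.update_of_ne (Finset.ne_of_mem_erase hi)]), hu]
    abel
  have h2 : ∑ i, Real.log (1 + |Function.update w j θ i|)
      = Real.log (1 + |θ|) + ∑ i ∈ Finset.univ.erase j, Real.log (1 + |w i|) := by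
    rw [← Finset.add_sum_erase _ _ (Finset.mem_univ j), Function.update_self,
      Finset.sum_congr rfl (fun i hi => by
        rw [Function.update_of_ne (Finset.ne_of_mem_erase hi)])]
  rw [laadObj, h1, h2, norm_sub_sq_real, norm_smul, inner_smul_right, hX, Real.norm_eq_abs]
  ring

lemma StrictConvexOn.quasiConvexFn {f : ℝ → ℝ} (hf : StrictConvexOn ℝ Set.univ f) :
    QuasiConvexFn f := by
  rintro x d l ⟨hl0, hl1⟩
  have h := hf.convexOn.le_on_segment' (Set.mem_univ x) (Set.mem_univ (x + d))
    (sub_nonneg.2 hl1) hl0 (by ring)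
  have hx : (1 - l) • x + l • (x + d) = x + l * d := by
    simp only [smul_eq_mul]
    ring
  rwa [hx] at h

lemma StrictConvexOn.hemivariate {f : ℝ → ℝ} (hf : StrictConvexOn ℝ Set.univ f) :
    Hemivariate f := by
  rintro a b hab ⟨c, hc⟩
  have h := hf.2 (Set.mem_univ a) (Set.mem_univ b) hab.ne
    (by norm_num : (0 : ℝ) < 1 / 2) (by norm_num : (0 : ℝ) < 1 / 2) (by norm_num)
  simp only [smul_eq_mul] at h
  rw [hc a ⟨le_rfl, hab.le⟩, hc b ⟨hab.le, le_rfl⟩,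
    hc _ ⟨by linarith, by linarith⟩] at h
  linarith

/-- If `‖X_j‖ = 1` for all `j` and `0 < r ≤ 1`, then every coordinate section
`β_j ↦ ℓ(β₁, …, β_p)` of the LAAD objective (other coordinates held fixed) is both
quasi-convex and hemivariate on ℝ. -/
theorem stmt_10 {n p : ℕ} (y : EuclideanSpace ℝ (Fin n))
    (X : Fin p → EuclideanSpace ℝ (Fin n)) (r : ℝ) (hr0 : 0 < r) (hr1 : r ≤ 1)
    (hX : ∀ j : Fin p, ‖X j‖ = 1) (j : Fin p) (w : Fin p → ℝ) :
    QuasiConvexFn (fun θ => laadObj y X r (Function.update w j θ)) ∧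
    Hemivariate (fun θ => laadObj y X r (Function.update w j θ)) := by
  obtain ⟨b, c, hbc⟩ := laadObj_update_eq y X r j (hX j) w
  have haff : ConvexOn ℝ Set.univ (fun θ : ℝ => b * θ + c) := by
    refine ⟨convex_univ, fun s _ t _ α β _ _ hαβ => le_of_eq ?_⟩
    simp only [smul_eq_mul]
    linear_combination (-c) * hαβ
  have hconv : StrictConvexOn ℝ Set.univ (fun θ => laadObj y X r (Function.update w j θ)) := by
    rw [funext hbc]
    exact ((strictConvexOn_half_sq_add_log hr1).comp_abs
      (strictMonoOn_half_sq_add_log hr0)).add_convexOn haff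
  exact ⟨hconv.quasiConvexFn, hconv.hemivariate⟩
end

section
/- Fix 0 < r ≤ 1, and for each z ∈ ℝ let θ̂(z) denote the unique global minimizer over ℝ of θ ↦ ℓ(θ | r, z). Then θ̂(z) − z → 0 as z → +∞. -/
/-- If `t` does at least as well as `z` itself in the objective `ℓ(· | r, z)`, then
`|t - z| ≤ 2 r / (1 + |t|)`. -/
lemma abs_sub_mul_le_of_laadLoss_le {r z t : ℝ} (hr : 0 ≤ r) (h : laadLoss r z t ≤ laadLoss r z z) :
    |t - z| * (1 + |t|) ≤ 2 * r := by
  have ht : 0 < 1 + |t| := by positivity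
  have hz : 0 < 1 + |z| := by positivity
  have hlog : Real.log (1 + |z|) - Real.log (1 + |t|) ≤ |t - z| / (1 + |t|) := by
    rw [← Real.log_div hz.ne' ht.ne']
    refine (Real.log_le_sub_one_of_pos (div_pos hz ht)).trans ?_
    rw [div_sub_one ht.ne']
    gcongr
    have := abs_sub_abs_le_abs_sub z t
    rw [abs_sub_comm z t] at this
    linarith
  have hsq : |t - z| ^ 2 ≤ 2 * r * (|t - z| / (1 + |t|)) := by
    rw [sq_abs]
    unfold laadLoss at h
    nlinarith [mul_le_mul_of_nonneg_left hlog hr]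
  rw [mul_div_assoc', le_div_iff₀ ht] at hsq
  rcases (abs_nonneg (t - z)).eq_or_lt with h0 | hpos
  · rw [← h0]
    linarith
  · refine le_of_mul_le_mul_left ?_ hpos
    linarith

/-- Fix `0 < r ≤ 1` and let `θ̂(z)` be the unique global minimizer over ℝ of
`θ ↦ ℓ(θ | r, z)`. Then `θ̂(z) − z → 0` as `z → +∞`. -/
theorem stmt_13 (r : ℝ) (hr0 : 0 < r) (hr1 : r ≤ 1) (θhat : ℝ → ℝ)
    (hmin : ∀ z θ : ℝ, θ ≠ θhat z → laadLoss r z (θhat z) < laadLoss r z θ) :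
    Filter.Tendsto (fun z => θhat z - z) Filter.atTop (nhds 0) := by
  have hle : ∀ z, laadLoss r z (θhat z) ≤ laadLoss r z z := fun z => by
    rcases eq_or_ne z (θhat z) with h | h
    · rw [← h]
    · exact (hmin z z h).le
  have hlim : Filter.Tendsto (fun z : ℝ => 2 / (z - 1)) Filter.atTop (nhds 0) :=
    tendsto_const_nhds.div_atTop (Filter.tendsto_atTop_add_const_right _ (-1) Filter.tendsto_id)
  refine squeeze_zero_norm' ?_ hlim
  filter_upwards [Filter.eventually_gt_atTop 1] with z hz
  have hmul := abs_sub_mul_le_of_laadLoss_le hr0.le (hle z)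
  have hd := abs_nonneg (θhat z - z)
  have hd2 : |θhat z - z| ≤ 2 := by nlinarith [mul_nonneg hd (abs_nonneg (θhat z))]
  have hlarge : z - 1 ≤ 1 + |θhat z| := by
    linarith [neg_abs_le (θhat z - z), le_abs_self (θhat z)]
  rw [Real.norm_eq_abs, le_div_iff₀ (by linarith)]
  linarith [mul_le_mul_of_nonneg_left hlarge hd]
end

section
/- Fix 0 < r ≤ 1, and for each z ∈ ℝ let θ̂(z) denote the unique global minimizer over ℝ of θ ↦ ℓ(θ | r, z). Then the map z ↦ θ̂(z) is continuous on ℝ. -/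
open Filter Topology

theorem continuous_laadLoss (r : ℝ) : Continuous fun p : ℝ × ℝ => laadLoss r p.1 p.2 := by
  unfold laadLoss
  have h : ∀ p : ℝ × ℝ, 1 + |p.2| ≠ 0 := fun p => by positivity
  have hlog : Continuous fun p : ℝ × ℝ => Real.log (1 + |p.2|) :=
    Continuous.log (by fun_prop) h
  fun_prop

theorem abs_le_of_laadLoss_le_zero {r z θ : ℝ} (hr : 0 ≤ r)
    (h : laadLoss r z θ ≤ laadLoss r z 0) : |θ| ≤ 2 * |z| := by
  have hlog : 0 ≤ r * Real.log (1 + |θ|) :=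
    mul_nonneg hr (Real.log_nonneg (by linarith [abs_nonneg θ]))
  simp only [laadLoss, abs_zero, add_zero, Real.log_one, mul_zero, sub_zero] at h
  have hsq : |z - θ| ≤ |z| := sq_le_sq.mp (by linarith)
  have htri : |θ| ≤ |z| + |z - θ| := by simpa using abs_sub z (z - θ)
  linarith

/-- Fix `0 < r ≤ 1` and let `θ̂(z)` be the unique global minimizer over ℝ of
`θ ↦ ℓ(θ | r, z)`. Then `z ↦ θ̂(z)` is continuous on ℝ. -/
theorem stmt_14 (r : ℝ) (hr0 : 0 < r) (hr1 : r ≤ 1) (θhat : ℝ → ℝ)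
    (hmin : ∀ z θ : ℝ, θ ≠ θhat z → laadLoss r z (θhat z) < laadLoss r z θ) :
    Continuous θhat := by
  have hle : ∀ z θ : ℝ, laadLoss r z (θhat z) ≤ laadLoss r z θ := fun z θ => by
    rcases eq_or_ne θ (θhat z) with rfl | h
    · exact le_rfl
    · exact (hmin z θ h).le
  refine continuous_iff_continuousAt.mpr fun z₀ => ?_
  refine (isCompact_closedBall (0 : ℝ) (2 * (|z₀| + 1))).tendsto_nhds_of_unique_mapClusterPt
    ?_ fun y _ hy => ?_
  · have hz : ∀ᶠ z in 𝓝 z₀, |z| < |z₀| + 1 :=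
      continuous_abs.continuousAt.eventually_lt continuousAt_const (lt_add_one _)
    filter_upwards [hz] with z hz
    rw [mem_closedBall_zero_iff, Real.norm_eq_abs]
    linarith [abs_le_of_laadLoss_le_zero hr0.le (hle z 0)]
  · obtain ⟨U, hU, hUy⟩ := mapClusterPt_iff_ultrafilter.mp hy
    have hlim : laadLoss r z₀ y ≤ laadLoss r z₀ (θhat z₀) :=
      le_of_tendsto_of_tendsto'
        (((continuous_laadLoss r).tendsto (z₀, y)).comp (Tendsto.prodMk_nhds hU hUy))
        (((continuous_laadLoss r).tendsto (z₀, θhat z₀)).comp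
          (Tendsto.prodMk_nhds hU tendsto_const_nhds))
        fun z => hle z (θhat z₀)
    by_contra hne
    exact (hmin z₀ y hne).not_ge hlim
end

section
/- The function f(t) = −log(1 + e^t) + log(1 + |t|) satisfies f(1/2) > max{f(0), f(1)}; hence f violates the quasi-convexity inequality with x = 0, d = 1, λ = 1/2, and so f is not quasi-convex on ℝ. -/
theorem neg_log_add_log_lt {a b c d : ℝ} (ha : 0 < a) (hb : 0 < b) (hc : 0 < c) (hd : 0 < d)
    (h : b * c < d * a) : -Real.log a + Real.log b < -Real.log c + Real.log d := by
  have key := Real.log_lt_log (mul_pos hb hc) h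
  rw [Real.log_mul hb.ne' hc.ne', Real.log_mul hd.ne' ha.ne'] at key
  linarith

/-- The function `f(t) = −log(1 + eᵗ) + log(1 + |t|)` satisfies
`f(1/2) > max {f(0), f(1)}`; hence `f` is not quasi-convex on ℝ. -/
theorem stmt_18 :
    (fun t : ℝ => -Real.log (1 + Real.exp t) + Real.log (1 + |t|)) (1 / 2)
      > max ((fun t : ℝ => -Real.log (1 + Real.exp t) + Real.log (1 + |t|)) 0)
          ((fun t : ℝ => -Real.log (1 + Real.exp t) + Real.log (1 + |t|)) 1) ∧
    ¬ QuasiConvexFn (fun t : ℝ => -Real.log (1 + Real.exp t) + Real.log (1 + |t|)) := by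
  have lower : (13 / 8 : ℝ) ≤ Real.exp (1 / 2) := by
    have := Real.quadratic_le_exp_of_nonneg (show (0 : ℝ) ≤ 1 / 2 by norm_num)
    linarith
  have sq : Real.exp 1 = Real.exp (1 / 2) * Real.exp (1 / 2) := by
    rw [← Real.exp_add]; norm_num
  have upper : Real.exp (1 / 2) < 2 := by
    nlinarith [Real.exp_one_lt_d9]
  have main : (fun t : ℝ => -Real.log (1 + Real.exp t) + Real.log (1 + |t|)) (1 / 2)
      > max ((fun t : ℝ => -Real.log (1 + Real.exp t) + Real.log (1 + |t|)) 0)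
          ((fun t : ℝ => -Real.log (1 + Real.exp t) + Real.log (1 + |t|)) 1) := by
    refine max_lt ?_ ?_ <;> refine neg_log_add_log_lt (by positivity) (by positivity)
      (by positivity) (by positivity) ?_
    · rw [abs_zero, Real.exp_zero, abs_of_pos (by norm_num : (0 : ℝ) < 1 / 2)]
      linarith
    · rw [abs_one, sq, abs_of_pos (by norm_num : (0 : ℝ) < 1 / 2)]
      nlinarith
  refine ⟨main, fun h => main.not_ge ?_⟩
  have := h 0 1 (1 / 2) ⟨by norm_num, by norm_num⟩
  rwa [mul_one, zero_add, zero_add] at this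
end
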